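/- arXiv:2107.03750 — 4 statements merged into one kernel-verified Lean document; each statement's English description precedes it below -/
import Mathlib

section
/- Let p ≥ 2 be a natural number and let G be a finite simple graph that is pK_2-free, bull-free and diamond-free. Then χ(G) ≤ max{4p − 4, ω(G)}. -/
open SimpleGraph

/-- `G` is `H`-free: no induced subgraph of `G` is isomorphic to `H`. -/
def IsIndFree {V W : Type*} (G : SimpleGraph V) (H : SimpleGraph W) : Prop :=
  ∀ s : Set V, ¬ Nonempty (H ≃g G.induce s)

/-- The bull: a triangle with two pendant edges at distinct vertices. -/
def bull : SimpleGraph (Fin 5) :=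
  SimpleGraph.fromEdgeSet {s(0,1), s(1,2), s(0,2), s(1,3), s(2,4)}

/-- The diamond: `K₄` minus an edge. -/
def diamond : SimpleGraph (Fin 4) :=
  SimpleGraph.fromEdgeSet {s(0,2), s(0,3), s(1,2), s(1,3), s(2,3)}
/-- `p·K₂`: the disjoint union of `p` edges (a perfect matching on `2p` vertices). -/
def pK2 (p : ℕ) : SimpleGraph (Fin p × Fin 2) :=
  SimpleGraph.fromRel (fun x y => x.1 = y.1)

theorem IsIndFree.false_of_embedding {V W : Type*} {G : SimpleGraph V} {H : SimpleGraph W}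
    (h : IsIndFree G H) (f : H ↪g G) : False := by
  refine h (Set.range f) ⟨⟨Equiv.ofInjective f f.injective, ?_⟩⟩
  intro a b
  simp

namespace SimpleGraph

variable {V : Type*}

/-- The vertices of `S` can be properly coloured with the colours `0, …, k - 1`. -/
def ColorableOn (G : SimpleGraph V) (S : Finset V) (k : ℕ) : Prop :=
  ∃ c : V → ℕ, (∀ v ∈ S, c v < k) ∧ ∀ u ∈ S, ∀ v ∈ S, G.Adj u v → c u ≠ c v

/-- The edges `a i b i` form an induced matching of size `n` inside `S`. -/
def HasInducedMatching (G : SimpleGraph V) (S : Finset V) (n : ℕ) : Prop :=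
  ∃ a b : Fin n → V, (∀ i, a i ∈ S ∧ b i ∈ S ∧ G.Adj (a i) (b i)) ∧
    ∀ i j, i ≠ j → ¬ G.Adj (a i) (a j) ∧ ¬ G.Adj (a i) (b j) ∧ ¬ G.Adj (b i) (b j)

theorem ColorableOn.mono {G : SimpleGraph V} {S : Finset V} {k l : ℕ} (h : G.ColorableOn S k)
    (hkl : k ≤ l) : G.ColorableOn S l := by
  obtain ⟨c, hc, hc'⟩ := h
  exact ⟨c, fun v hv => (hc v hv).trans_le hkl, hc'⟩

theorem ColorableOn.colorable [Fintype V] {G : SimpleGraph V} {k : ℕ}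
    (h : G.ColorableOn Finset.univ k) : G.Colorable k := by
  obtain ⟨c, hc, hc'⟩ := h
  refine ⟨Coloring.mk (fun v => ⟨c v, hc v (Finset.mem_univ v)⟩) ?_⟩
  intro u v huv h
  exact hc' u (Finset.mem_univ u) v (Finset.mem_univ v) huv (Fin.mk.inj_iff.mp h)

theorem HasInducedMatching.nonempty_embedding {G : SimpleGraph V} {S : Finset V} {n : ℕ}
    (h : G.HasInducedMatching S n) : Nonempty (pK2 n ↪g G) := by
  obtain ⟨a, b, h1, h2⟩ := h
  have hba : ∀ i j, i ≠ j → ¬ G.Adj (b i) (a j) := fun i j hij hadj =>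
    (h2 j i hij.symm).2.1 hadj.symm
  let f : Fin n × Fin 2 → V := fun x => if x.2 = 0 then a x.1 else b x.1
  have hadj : ∀ x y, G.Adj (f x) (f y) ↔ (pK2 n).Adj x y := by
    rintro ⟨i, s⟩ ⟨j, t⟩
    by_cases hij : i = j
    · subst hij
      have := (h1 i).2.2
      fin_cases s <;> fin_cases t <;> simp [f, pK2, this, this.symm]
    · obtain ⟨h3, h4, h5⟩ := h2 i j hij
      have h6 := hba i j hij
      fin_cases s <;> fin_cases t <;> simp [f, pK2, hij, Ne.symm hij, h3, h4, h5, h6]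
  have hinj : Function.Injective f := by
    rintro ⟨i, s⟩ ⟨j, t⟩ hst
    have key : ∀ z, (pK2 n).Adj (i, s) z ↔ (pK2 n).Adj (j, t) z := by
      intro z
      rw [← hadj, ← hadj, hst]
    have e1 := key (i, 1 - s)
    have e2 := key (j, t)
    have e3 := key (i, s)
    fin_cases s <;> fin_cases t <;> simp_all [pK2]
  exact ⟨⟨⟨f, hinj⟩, fun {x y} => hadj x y⟩⟩

open Classical in
theorem hasInducedMatching_or_colorableOn (G : SimpleGraph V) (n : ℕ) (S : Finset V)
    (hS : ∀ u ∈ S, ∀ v ∈ S, ∀ w ∈ S, G.Adj u v → G.Adj u w → ¬ G.Adj v w) :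
    G.HasInducedMatching S n ∨ G.ColorableOn S (2 * n - 1) := by
  induction n generalizing S with
  | zero => exact Or.inl ⟨Fin.elim0, Fin.elim0, fun i => i.elim0, fun i => i.elim0⟩
  | succ n ih =>
    by_cases hE : ∃ u ∈ S, ∃ v ∈ S, G.Adj u v
    · obtain ⟨u, hu, v, hv, huv⟩ := hE
      let T := S.filter fun w => ¬ G.Adj u w ∧ ¬ G.Adj v w
      have hT : ∀ w, w ∈ T ↔ w ∈ S ∧ ¬ G.Adj u w ∧ ¬ G.Adj v w := fun w => Finset.mem_filter
      rcases ih T (fun x hx y hy z hz =>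
        hS x ((hT x).1 hx).1 y ((hT y).1 hy).1 z ((hT z).1 hz).1) with h | h
      · left
        obtain ⟨a, b, h1, h2⟩ := h
        refine ⟨Fin.cons u a, Fin.cons v b, ?_, ?_⟩
        · refine Fin.cases ⟨hu, hv, huv⟩ fun i => ?_
          obtain ⟨ha, hb, hab⟩ := h1 i
          exact ⟨((hT _).1 ha).1, ((hT _).1 hb).1, hab⟩
        · intro i j
          refine Fin.cases ?_ (fun i => ?_) i <;> refine Fin.cases ?_ (fun j => ?_) j
          · exact fun h => (h rfl).elim
          · intro _
            obtain ⟨ha, hb, -⟩ := h1 j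
            exact ⟨((hT _).1 ha).2.1, ((hT _).1 hb).2.1, ((hT _).1 hb).2.2⟩
          · intro _
            obtain ⟨ha, hb, -⟩ := h1 i
            exact ⟨fun h => ((hT _).1 ha).2.1 h.symm, fun h => ((hT _).1 ha).2.2 h.symm,
              fun h => ((hT _).1 hb).2.2 h.symm⟩
          · intro hij
            exact h2 i j fun h => hij (by rw [h])
      · rcases n.eq_zero_or_pos with rfl | hn
        · left
          refine ⟨fun _ => u, fun _ => v, fun _ => ⟨hu, hv, huv⟩, fun i j hij => ?_⟩
          exact (hij (Subsingleton.elim (α := Fin 1) i j)).elim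
        right
        obtain ⟨c, hc, hc'⟩ := h
        refine ⟨fun w => if G.Adj u w then 2 * n else if G.Adj v w then 2 * n - 1 else c w,
          ?_, ?_⟩
        · intro w hw
          have := fun hw' => hc w ((hT w).2 hw')
          dsimp only
          split_ifs with h1 h2
          · omega
          · omega
          · have := this ⟨hw, h1, h2⟩
            omega
        · intro x hx y hy hxy
          have h1 := fun h => hc x ((hT x).2 h)
          have h2 := fun h => hc y ((hT y).2 h)
          have h3 := fun h h' => hc' x ((hT x).2 h) y ((hT y).2 h') hxy
          have h4 := fun h h' => hS u hu x hx y hy h h' hxy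
          have h5 := fun h h' => hS v hv x hx y hy h h' hxy
          dsimp only
          split_ifs <;> grind
    · right
      refine ⟨fun _ => 0, fun _ _ => show 0 < _ by omega, fun u hu v hv huv => ?_⟩
      exact (hE ⟨u, hu, v, hv, huv⟩).elim

open Classical in
/-- A colouring of `S` minus a vertex of a clique `C` extends to `S` when the vertex has no
neighbour in `S` outside `C`. -/
theorem ColorableOn.of_erase {G : SimpleGraph V} {S C : Finset V} {k : ℕ} {v : V}
    (h : G.ColorableOn (S.erase v) k) (hv : v ∈ C) (hC : C.card ≤ k)
    (hN : ∀ w ∈ S, G.Adj v w → w ∈ C) : G.ColorableOn S k := by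
  obtain ⟨c, hc, hc'⟩ := h
  have hcard : ((C.erase v).image c).card < (Finset.range k).card := by
    have h1 : ((C.erase v).image c).card ≤ (C.erase v).card := Finset.card_image_le
    have h2 := Finset.card_erase_lt_of_mem hv
    rw [Finset.card_range]
    omega
  obtain ⟨t, ht, ht'⟩ := Finset.exists_mem_notMem_of_card_lt_card hcard
  have htc : ∀ w ∈ S, G.Adj v w → c w ≠ t := fun w hw hvw he => ht' <|
    Finset.mem_image.2 ⟨w, Finset.mem_erase.2 ⟨hvw.ne', hN w hw hvw⟩, he⟩
  refine ⟨Function.update c v t, ?_, ?_⟩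
  · intro w hw
    by_cases hwv : w = v
    · subst hwv
      simpa using ht
    · simpa [hwv] using hc w (Finset.mem_erase.2 ⟨hwv, hw⟩)
  · intro x hx y hy hxy
    by_cases hxv : x = v
    · subst hxv
      simpa [hxy.ne'] using (htc y hy hxy).symm
    · by_cases hyv : y = v
      · subst hyv
        simpa [hxv] using htc x hx hxy.symm
      · simpa [hxv, hyv] using
          hc' x (Finset.mem_erase.2 ⟨hxv, hx⟩) y (Finset.mem_erase.2 ⟨hyv, hy⟩) hxy

open Classical in
/-- Suppose that every vertex `v` of `C` has exactly one neighbour `f v` in `S` outside `C`, and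
that these neighbours are pairwise adjacent. Then a colouring of `S \ C` extends to `S`: permute
the colours of the neighbours along a derangement of `C`. -/
theorem ColorableOn.of_sdiff {G : SimpleGraph V} {S C : Finset V} {k : ℕ}
    (h : G.ColorableOn (S \ C) k) (hC : 2 ≤ C.card) (f : V → V)
    (hf : ∀ v ∈ C, f v ∈ S \ C) (hf' : ∀ v ∈ C, ∀ w ∈ S \ C, G.Adj v w → w = f v)
    (hclique : ∀ u ∈ C, ∀ v ∈ C, u ≠ v → G.Adj (f u) (f v)) : G.ColorableOn S k := by
  obtain ⟨c, hc, hc'⟩ := h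
  let σ := C.toList.formPerm
  have hσ : ∀ v ∈ C, σ v ∈ C := fun v hv =>
    Finset.mem_toList.1 (List.formPerm_apply_mem_of_mem (Finset.mem_toList.2 hv))
  have hσ' : ∀ v ∈ C, σ v ≠ v := fun v hv =>
    (List.formPerm_apply_mem_ne_self_iff _ C.nodup_toList v (Finset.mem_toList.2 hv)).2
      (by simpa using hC)
  have hne : ∀ u ∈ C, ∀ v ∈ C, u ≠ v → c (f u) ≠ c (f v) := fun u hu v hv huv =>
    hc' _ (hf u hu) _ (hf v hv) (hclique u hu v hv huv)
  refine ⟨fun v => if v ∈ C then c (f (σ v)) else c v, ?_, ?_⟩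
  · intro v hv
    dsimp only
    split_ifs with h
    · exact hc _ (hf _ (hσ v h))
    · exact hc _ (Finset.mem_sdiff.2 ⟨hv, h⟩)
  · intro x hx y hy hxy
    dsimp only
    split_ifs with h1 h2 h2
    · exact hne _ (hσ x h1) _ (hσ y h2) (σ.injective.ne hxy.ne)
    · rw [hf' x h1 y (Finset.mem_sdiff.2 ⟨hy, h2⟩) hxy]
      exact hne _ (hσ x h1) _ h1 (hσ' x h1)
    · rw [hf' y h2 x (Finset.mem_sdiff.2 ⟨hx, h1⟩) hxy.symm]
      exact hne _ h2 _ (hσ y h2) (hσ' y h2).symm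
    · exact hc' _ (Finset.mem_sdiff.2 ⟨hx, h1⟩) _ (Finset.mem_sdiff.2 ⟨hy, h2⟩) hxy

end SimpleGraph

theorem IsIndFree.adj_of_diamond {V : Type*} {G : SimpleGraph V} (h : IsIndFree G diamond)
    {a b x y : V} (hab : G.Adj a b) (hax : G.Adj a x) (hay : G.Adj a y) (hbx : G.Adj b x)
    (hby : G.Adj b y) (hxy : x ≠ y) : G.Adj x y := by
  by_contra hn
  have hn' : ¬ G.Adj y x := fun h => hn h.symm
  have hadj : ∀ i j, G.Adj (![x, y, a, b] i) (![x, y, a, b] j) ↔ diamond.Adj i j := by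
    intro i j
    fin_cases i <;> fin_cases j <;>
      simp [diamond, hn, hn', hab, hax, hay, hbx, hby, hab.symm, hax.symm, hay.symm, hbx.symm,
        hby.symm]
  refine h.false_of_embedding ⟨⟨![x, y, a, b], ?_⟩, fun {i j} => hadj i j⟩
  intro i j hij
  fin_cases i <;> fin_cases j <;>
    simp_all [hxy.symm, hab.ne, hax.ne, hay.ne, hbx.ne, hby.ne, hab.ne', hax.ne', hay.ne',
      hbx.ne', hby.ne']

theorem IsIndFree.adj_of_bull {V : Type*} {G : SimpleGraph V} (h : IsIndFree G bull)
    {a b c x y : V} (hab : G.Adj a b) (hac : G.Adj a c) (hbc : G.Adj b c) (hbx : G.Adj b x)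
    (hcy : G.Adj c y) (hax : ¬ G.Adj a x) (hay : ¬ G.Adj a y) (hby : ¬ G.Adj b y)
    (hcx : ¬ G.Adj c x) : G.Adj x y := by
  by_contra hn
  have hs : ∀ {u v}, ¬ G.Adj u v → ¬ G.Adj v u := fun h h' => h h'.symm
  have hadj : ∀ i j, G.Adj (![a, b, c, x, y] i) (![a, b, c, x, y] j) ↔ bull.Adj i j := by
    intro i j
    fin_cases i <;> fin_cases j <;>
      simp [bull, hn, hax, hay, hby, hcx, hs hn, hs hax, hs hay, hs hby, hs hcx, hab, hac, hbc,
        hbx, hcy, hab.symm, hac.symm, hbc.symm, hbx.symm, hcy.symm]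
  have h1 : a ≠ x := by rintro rfl; exact hcx hac.symm
  have h2 : a ≠ y := by rintro rfl; exact hby hab.symm
  have h3 : x ≠ y := by rintro rfl; exact hby hbx
  have h4 : b ≠ y := by rintro rfl; exact hay hab
  have h5 : c ≠ x := by rintro rfl; exact hax hac
  refine h.false_of_embedding ⟨⟨![a, b, c, x, y], ?_⟩, fun {i j} => hadj i j⟩
  intro i j hij
  fin_cases i <;> fin_cases j <;>
    simp_all [hab.ne, hac.ne, hbc.ne, hbx.ne, hcy.ne, hab.ne', hac.ne', hbc.ne', hbx.ne',
      hcy.ne', h1.symm, h2.symm, h3.symm, h4.symm, h5.symm]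

namespace SimpleGraph

open Classical in
/-- In a bull-free and diamond-free graph, if each vertex of a maximal clique `C` of `S` with at
least three vertices has a neighbour in `S \ C`, then these neighbours are unique and pairwise
adjacent. -/
theorem ColorableOn.of_maximal_clique {V : Type*} {G : SimpleGraph V} {S C : Finset V} {k : ℕ}
    (hGb : IsIndFree G bull) (hGd : IsIndFree G diamond)
    (hmax : Maximal (fun D : Finset V => D ⊆ S ∧ G.IsClique D) C) (hC : 3 ≤ C.card)
    (hN : ∀ v ∈ C, ∃ w ∈ S, G.Adj v w ∧ w ∉ C) (h : G.ColorableOn (S \ C) k) :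
    G.ColorableOn S k := by
  have hcl : ∀ u ∈ C, ∀ v ∈ C, u ≠ v → G.Adj u v := fun u hu v hv huv =>
    hmax.prop.2 (Finset.mem_coe.2 hu) (Finset.mem_coe.2 hv) huv
  have hone : ∀ x ∈ S, x ∉ C → ∀ u ∈ C, ∀ v ∈ C, u ≠ v → G.Adj u x → ¬ G.Adj v x := by
    intro x hx hxC u hu v hv huv hux hvx
    refine hxC (hmax.le_of_ge ⟨Finset.insert_subset hx hmax.prop.1, ?_⟩
      (Finset.subset_insert x C) (Finset.mem_insert_self x C))
    rw [Finset.coe_insert, isClique_insert]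
    refine ⟨hmax.prop.2, fun w hw hxw => ?_⟩
    have hw : w ∈ C := hw
    by_cases hwu : w = u
    · exact hwu ▸ hux.symm
    by_cases hwv : w = v
    · exact hwv ▸ hvx.symm
    exact hGd.adj_of_diamond (hcl u hu v hv huv) hux (hcl u hu w hw (Ne.symm hwu)) hvx
      (hcl v hv w hw (Ne.symm hwv)) hxw
  have hthird : ∀ u v, ∃ w ∈ C, w ≠ u ∧ w ≠ v := by
    intro u v
    obtain ⟨w, hw, hw'⟩ := Finset.exists_mem_notMem_of_card_lt_card
      (s := {u, v}) (t := C) (Finset.card_le_two.trans_lt hC)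
    exact ⟨w, hw, by simpa using hw'⟩
  have hcross : ∀ x ∈ S, x ∉ C → ∀ y ∈ S, y ∉ C → ∀ u ∈ C, ∀ v ∈ C, u ≠ v →
      G.Adj u x → G.Adj v y → G.Adj x y := by
    intro x hx hxC y hy hyC u hu v hv huv hux hvy
    obtain ⟨w, hw, hwu, hwv⟩ := hthird u v
    exact hGb.adj_of_bull (hcl w hw u hu hwu) (hcl w hw v hv hwv) (hcl u hu v hv huv) hux hvy
      (hone x hx hxC u hu w hw hwu.symm hux) (hone y hy hyC v hv w hw hwv.symm hvy)
      (hone y hy hyC v hv u hu huv.symm hvy) (hone x hx hxC u hu v hv huv hux)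
  choose! f hfS hfadj hfC using hN
  refine h.of_sdiff (by omega) f (fun v hv => Finset.mem_sdiff.2 ⟨hfS v hv, hfC v hv⟩) ?_ ?_
  · intro u hu x hx hux
    obtain ⟨hx, hxC⟩ := Finset.mem_sdiff.1 hx
    by_contra hne
    obtain ⟨v, hv, hvu, -⟩ := hthird u u
    obtain ⟨w, hw, hwu, hwv⟩ := hthird u v
    have key : ∀ z ∈ S, z ∉ C → G.Adj u z → ∀ t ∈ C, t ≠ u → G.Adj (f t) z :=
      fun z hz hzC huz t ht htu => hcross (f t) (hfS t ht) (hfC t ht) z hz hzC t ht u hu htu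
        (hfadj t ht) huz
    have hvw : G.Adj (f v) (f w) := hcross _ (hfS v hv) (hfC v hv) _ (hfS w hw) (hfC w hw) v hv w
      hw hwv.symm (hfadj v hv) (hfadj w hw)
    have hvx := key x hx hxC hux v hv hvu
    have hvf := key (f u) (hfS u hu) (hfC u hu) (hfadj u hu) v hv hvu
    have hxf : G.Adj x (f u) := hGd.adj_of_diamond hvw hvx hvf (key x hx hxC hux w hw hwu)
      (key (f u) (hfS u hu) (hfC u hu) (hfadj u hu) w hw hwu) hne
    have huv : G.Adj u (f v) := hGd.adj_of_diamond hxf hux.symm hvx.symm (hfadj u hu).symm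
      hvf.symm (fun h => hfC v hv (h ▸ hu))
    exact hone (f v) (hfS v hv) (hfC v hv) u hu v hv hvu.symm huv (hfadj v hv)
  · intro u hu v hv huv
    exact hcross _ (hfS u hu) (hfC u hu) _ (hfS v hv) (hfC v hv) u hu v hv huv (hfadj u hu)
      (hfadj v hv)

open Classical in
theorem colorableOn_of_isIndFree {V : Type*} [Fintype V] {G : SimpleGraph V} {p : ℕ}
    (hGm : IsIndFree G (pK2 p)) (hGb : IsIndFree G bull) (hGd : IsIndFree G diamond)
    (S : Finset V) : G.ColorableOn S (max (2 * p - 1) G.cliqueNum) := by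
  induction S using Finset.strongInduction with
  | H S ih =>
  by_cases hS : ∀ u ∈ S, ∀ v ∈ S, ∀ w ∈ S, G.Adj u v → G.Adj u w → ¬ G.Adj v w
  · rcases hasInducedMatching_or_colorableOn G p S hS with h | h
    · exact h.nonempty_embedding.elim fun f => (hGm.false_of_embedding f).elim
    · exact h.mono (le_max_left _ _)
  push Not at hS
  obtain ⟨u, hu, v, hv, w, hw, huv, huw, hvw⟩ := hS
  obtain ⟨C, hle, hmax⟩ := (Set.toFinite {D : Finset V | D ⊆ S ∧ G.IsClique D}).exists_le_maximal
    (a := {u, v, w}) (by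
      refine ⟨?_, ?_⟩
      · simp [Finset.insert_subset_iff, hu, hv, hw]
      · exact (is3Clique_triple_iff.2 ⟨huv, huw, hvw⟩).isClique)
  have hC : 3 ≤ C.card :=
    (is3Clique_triple_iff.2 ⟨huv, huw, hvw⟩).card_eq ▸ Finset.card_le_card hle
  have hCS : C ⊆ S := hmax.prop.1
  by_cases hN : ∀ v ∈ C, ∃ w ∈ S, G.Adj v w ∧ w ∉ C
  · refine ColorableOn.of_maximal_clique hGb hGd hmax hC hN (ih _ ?_)
    exact Finset.sdiff_ssubset hCS (Finset.card_pos.1 (by omega))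
  · push Not at hN
    obtain ⟨x, hx, hN⟩ := hN
    exact (ih _ (Finset.erase_ssubset (hCS hx))).of_erase hx
      (hmax.prop.2.card_le_cliqueNum.trans (le_max_right _ _)) hN

end SimpleGraph

theorem statement_12 (p : ℕ) (hp : 2 ≤ p) {V : Type*} [Fintype V] (G : SimpleGraph V)
    (hGm : IsIndFree G (pK2 p)) (hGb : IsIndFree G bull)
    (hGd : IsIndFree G diamond) :
    G.chromaticNumber ≤ (max (4 * p - 4) G.cliqueNum : ℕ∞) := by
  have h := (colorableOn_of_isIndFree hGm hGb hGd Finset.univ).mono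
    (max_le_max_right G.cliqueNum (show 2 * p - 1 ≤ 4 * p - 4 by omega))
  exact_mod_cast h.colorable.chromaticNumber_le
end

section
/- Let G be a finite simple graph that is chair-free, bull-free and diamond-free. Then χ(G) ≤ max{6, ω(G)}. -/
open SimpleGraph

/-- The chair: a path on four vertices with an extra pendant at its third vertex. -/
def chair : SimpleGraph (Fin 5) :=
  SimpleGraph.fromEdgeSet {s(0,1), s(1,2), s(2,3), s(2,4)}

section ChairBullDiamond

variable {V W : Type*} {G : SimpleGraph V} {H : SimpleGraph W}

theorem IsIndFree.isEmpty_embedding (h : IsIndFree G H) : IsEmpty (H ↪g G) := by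
  refine ⟨fun f => h (Set.range f) ⟨⟨Equiv.ofInjective f f.injective, ?_⟩⟩⟩
  intro a b
  simp

theorem IsIndFree.of_embedding {V' : Type*} {G' : SimpleGraph V'} (h : IsIndFree G H)
    (f : G' ↪g G) : IsIndFree G' H := fun s ⟨e⟩ =>
  h.isEmpty_embedding.false (f.comp ((Embedding.induce s).comp e.toEmbedding))

theorem IsIndFree.not_forall_lt [LinearOrder W] (h : IsIndFree G H) (f : W → V)
    (hf : ∀ i j, i < j → f i ≠ f j ∧ (G.Adj (f i) (f j) ↔ H.Adj i j)) : False := by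
  refine h.isEmpty_embedding.false ⟨⟨f, fun i j hij => ?_⟩, fun {i j} => ?_⟩
  · rcases lt_trichotomy i j with hlt | heq | hlt
    · exact absurd hij (hf i j hlt).1
    · exact heq
    · exact absurd hij.symm (hf j i hlt).1
  · rcases lt_trichotomy i j with hlt | rfl | hlt
    · exact (hf i j hlt).2
    · simp
    · rw [G.adj_comm, H.adj_comm]
      exact (hf j i hlt).2

theorem IsIndFree.not_chair (h : IsIndFree G chair) {a b c d e : V} (hab : G.Adj a b)
    (hbc : G.Adj b c) (hcd : G.Adj c d) (hce : G.Adj c e) (hac : ¬ G.Adj a c)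
    (had : ¬ G.Adj a d) (hae : ¬ G.Adj a e) (hbd : ¬ G.Adj b d) (hbe : ¬ G.Adj b e)
    (hde : ¬ G.Adj d e) (hne : d ≠ e) : False := by
  have nac : a ≠ c := by rintro rfl; exact had hcd
  have nad : a ≠ d := by rintro rfl; exact hbd hab.symm
  have nae : a ≠ e := by rintro rfl; exact hbe hab.symm
  have nbd : b ≠ d := by rintro rfl; exact had hab
  have nbe : b ≠ e := by rintro rfl; exact hae hab
  refine h.not_forall_lt ![a, b, c, d, e] fun i j hij => ?_
  fin_cases i <;> fin_cases j <;> first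
    | exact absurd hij (by decide)
    | simp [chair, hab, hbc, hcd, hce, hac, had, hae, hbd, hbe, hde, hab.ne, hbc.ne, hcd.ne,
        hce.ne, nac, nad, nae, nbd, nbe, hne]

theorem IsIndFree.not_bull (h : IsIndFree G bull) {a b c d e : V} (hab : G.Adj a b)
    (hbc : G.Adj b c) (hac : G.Adj a c) (hbd : G.Adj b d) (hce : G.Adj c e)
    (had : ¬ G.Adj a d) (hae : ¬ G.Adj a e) (hbe : ¬ G.Adj b e) (hcd : ¬ G.Adj c d)
    (hde : ¬ G.Adj d e) : False := by
  have nad : a ≠ d := by rintro rfl; exact hcd hac.symm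
  have nae : a ≠ e := by rintro rfl; exact hbe hab.symm
  have nbe : b ≠ e := by rintro rfl; exact hae hab
  have ncd : c ≠ d := by rintro rfl; exact had hac
  have nde : d ≠ e := by rintro rfl; exact hbe hbd
  refine h.not_forall_lt ![a, b, c, d, e] fun i j hij => ?_
  fin_cases i <;> fin_cases j <;> first
    | exact absurd hij (by decide)
    | simp [bull, hab, hbc, hac, hbd, hce, had, hae, hbe, hcd, hde, hab.ne, hbc.ne, hac.ne,
        hbd.ne, hce.ne, nad, nae, nbe, ncd, nde]

theorem IsIndFree.not_diamond (h : IsIndFree G diamond) {a b c d : V} (hac : G.Adj a c)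
    (had : G.Adj a d) (hbc : G.Adj b c) (hbd : G.Adj b d) (hcd : G.Adj c d)
    (hab : ¬ G.Adj a b) (hne : a ≠ b) : False := by
  refine h.not_forall_lt ![a, b, c, d] fun i j hij => ?_
  fin_cases i <;> fin_cases j <;> first
    | exact absurd hij (by decide)
    | simp [diamond, hac, had, hbc, hbd, hcd, hab, hac.ne, had.ne, hbc.ne, hbd.ne, hcd.ne, hne]

/-- In a triangle-free chair-free graph, the component of a vertex with at least three neighbours
is bipartite. -/
theorem IsIndFree.exists_two_coloring_of_chair (hG : IsIndFree G chair)
    (htri : ∀ a b c, G.Adj a b → G.Adj b c → ¬ G.Adj a c) {c p q r : V}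
    (hp : G.Adj c p) (hq : G.Adj c q) (hr : G.Adj c r) (hpq : p ≠ q) (hpr : p ≠ r) (hqr : q ≠ r)
    {α : Type*} {x y : α} (hxy : x ≠ y) :
    ∃ (S : Set V) (f : V → α), c ∈ S ∧ (∀ u ∈ S, ∀ v, G.Adj u v → v ∈ S) ∧
      ∀ u ∈ S, ∀ v ∈ S, G.Adj u v → f u ≠ f v := by
  classical
  let N2 : Set V := {a | a ≠ c ∧ ∃ b, G.Adj c b ∧ G.Adj b a}
  let N3 : Set V := {z | ¬ G.Adj c z ∧ ∃ a ∈ N2, G.Adj a z}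
  have two_of_three : ∀ a ∈ N2, ∀ d e, G.Adj c d → G.Adj c e → d ≠ e →
      G.Adj d a ∨ G.Adj e a := by
    rintro a ⟨hac, b, hcb, hba⟩ d e hd he hde
    by_contra! hcon
    have hbd : b ≠ d := by rintro rfl; exact hcon.1 hba
    have hbe : b ≠ e := by rintro rfl; exact hcon.2 hba
    exact hG.not_chair hba.symm hcb.symm hd he (fun h => htri _ _ _ hcb hba h.symm)
      (fun h => hcon.1 h.symm) (fun h => hcon.2 h.symm) (fun h => htri _ _ _ hcb h hd)
      (fun h => htri _ _ _ hcb h he) (fun h => htri _ _ _ hd h he) hde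
  have pair : ∀ a ∈ N2, ∃ d e, d ≠ e ∧ G.Adj c d ∧ G.Adj c e ∧ G.Adj d a ∧ G.Adj e a := by
    intro a ha
    have h1 := two_of_three a ha p q hp hq hpq
    have h2 := two_of_three a ha p r hp hr hpr
    have h3 := two_of_three a ha q r hq hr hqr
    grind
  have indep2 : ∀ a ∈ N2, ∀ a' ∈ N2, ¬ G.Adj a a' := by
    intro a ha a' ha' h
    obtain ⟨d, e, hde, hd, he, hda, hea⟩ := pair a ha
    rcases two_of_three a' ha' d e hd he hde with h' | h'
    · exact htri _ _ _ hda h h'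
    · exact htri _ _ _ hea h h'
  have indep1 : ∀ a b, G.Adj c a → G.Adj c b → ¬ G.Adj a b :=
    fun a b ha hb h => htri _ _ _ ha h hb
  have disj12 : ∀ a ∈ N2, ¬ G.Adj c a := by
    rintro a ⟨-, b, hcb, hba⟩ h
    exact htri _ _ _ hcb hba h
  have disj23 : ∀ a ∈ N2, a ∉ N3 := by
    rintro a ha ⟨-, b, hb, hba⟩
    exact indep2 b hb a ha hba
  have closed3 : ∀ z ∈ N3, ∀ y, G.Adj z y → y ∈ N2 := by
    rintro z hz y hzy
    by_contra hy
    obtain ⟨hcz, a, ha, haz⟩ := hz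
    have hzc : z ≠ c := by rintro rfl; exact disj12 a ha haz.symm
    have hyc : y ≠ c := by rintro rfl; exact hcz hzy.symm
    obtain ⟨d, e, hde, hd, he, hda, hea⟩ := pair a ha
    have hz2 : z ∉ N2 := fun h => indep2 a ha z h haz
    have hzb : ∀ b, G.Adj c b → ¬ G.Adj b z := fun b hb h => hz2 ⟨hzc, b, hb, h⟩
    have hyb : ∀ b, G.Adj c b → ¬ G.Adj b y := fun b hb h => hy ⟨hyc, b, hb, h⟩
    exact hG.not_chair hzy.symm haz.symm hda.symm hea.symm (fun h => htri _ _ _ haz hzy h.symm)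
      (fun h => hyb d hd h.symm) (fun h => hyb e he h.symm) (fun h => hzb d hd h.symm)
      (fun h => hzb e he h.symm) (indep1 d e hd he) hde
  have hcc : ¬ G.Adj c c := G.loopless.irrefl c
  have hc2 : c ∉ N2 := fun h => h.1 rfl
  have hN1 : ∀ b, G.Adj c b → ∀ v, G.Adj b v → v = c ∨ v ∈ N2 := by
    intro b hb v hv
    by_cases hvc : v = c
    · exact .inl hvc
    · exact .inr ⟨hvc, b, hb, hv⟩
  have hN2 : ∀ b ∈ N2, ∀ v, G.Adj b v → G.Adj c v ∨ v ∈ N3 := by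
    intro b hb v hv
    by_cases hvc : G.Adj c v
    · exact .inl hvc
    · exact .inr ⟨hvc, b, hb, hv⟩
  have hc3 : c ∉ N3 := fun ⟨_, a, ha, h⟩ => disj12 a ha h.symm
  clear_value N2 N3
  refine ⟨{v | v = c ∨ G.Adj c v ∨ v ∈ N2 ∨ v ∈ N3},
    fun v => if v = c ∨ v ∈ N2 then x else y, .inl rfl, ?_, ?_⟩
  · rintro u (rfl | hu | hu | hu) v huv
    · exact .inr (.inl huv)
    · grind
    · grind
    · grind
  · have key : ∀ u v, (u = c ∨ G.Adj c u ∨ u ∈ N2 ∨ u ∈ N3) → G.Adj u v →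
        ((u = c ∨ u ∈ N2) ↔ ¬ (v = c ∨ v ∈ N2)) := by
      rintro u v (rfl | hu | hu | hu) huv
      · grind
      · grind
      · grind
      · grind
    intro u hu v hv huv
    have := key u v hu huv
    grind

/-- If every vertex of a maximal clique with at least three vertices has a neighbour outside the
clique, then these neighbours are unique and pairwise adjacent. -/
theorem IsIndFree.exists_private_neighbor (hb : IsIndFree G bull) (hd : IsIndFree G diamond)
    {K : Finset V} (hK : G.IsClique K) (hcard : 3 ≤ K.card)
    (hmax : ∀ v ∉ K, ∃ z ∈ K, ¬ G.Adj v z) (hout : ∀ x ∈ K, ∃ y ∉ K, G.Adj x y) :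
    ∃ n : V → V, (∀ x ∈ K, n x ∉ K ∧ ∀ y ∉ K, G.Adj x y ↔ y = n x) ∧
      ∀ x ∈ K, ∀ x' ∈ K, x ≠ x' → G.Adj (n x) (n x') := by
  classical
  have uniq : ∀ v ∉ K, ∀ x ∈ K, ∀ y ∈ K, x ≠ y → G.Adj x v → ¬ G.Adj y v := by
    intro v hv x hx y hy hxy hxv hyv
    obtain ⟨z, hz, hvz⟩ := hmax v hv
    have hzx : z ≠ x := by rintro rfl; exact hvz hxv.symm
    have hzy : z ≠ y := by rintro rfl; exact hvz hyv.symm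
    exact hd.not_diamond (hK hz hx hzx) (hK hz hy hzy) hxv.symm hyv.symm (hK hx hy hxy)
      (fun h => hvz h.symm) (by rintro rfl; exact hv hz)
  have third : ∀ x x', ∃ z ∈ K, z ≠ x ∧ z ≠ x' := by
    intro x x'
    have h : ({x, x'} : Finset V).card < K.card := Finset.card_le_two.trans_lt (by omega)
    obtain ⟨z, hz, hz'⟩ := Finset.exists_mem_notMem_of_card_lt_card h
    exact ⟨z, hz, by simpa using hz'⟩
  have compl : ∀ x ∈ K, ∀ x' ∈ K, x ≠ x' → ∀ y ∉ K, ∀ y' ∉ K, G.Adj x y → G.Adj x' y' →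
      G.Adj y y' := by
    intro x hx x' hx' hne y hy y' hy' hxy hxy'
    by_contra hcon
    obtain ⟨z, hz, hzx, hzx'⟩ := third x x'
    exact hb.not_bull (hK hz hx hzx) (hK hx hx' hne) (hK hz hx' hzx') hxy hxy'
      (uniq y hy x hx z hz hzx.symm hxy) (uniq y' hy' x' hx' z hz hzx'.symm hxy')
      (uniq y' hy' x' hx' x hx hne.symm hxy') (uniq y hy x hx x' hx' hne hxy) hcon
  have single : ∀ x ∈ K, ∀ y ∉ K, ∀ y' ∉ K, G.Adj x y → G.Adj x y' → y = y' := by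
    intro x hx y hy y' hy' hxy hxy'
    by_contra hne
    obtain ⟨z, hz, hzx, -⟩ := third x x
    obtain ⟨w, hw, hwx, hwz⟩ := third x z
    obtain ⟨u, hu, hzu⟩ := hout z hz
    obtain ⟨t, ht, hwt⟩ := hout w hw
    have hyu := compl x hx z hz hzx.symm y hy u hu hxy hzu
    have hyu' := compl x hx z hz hzx.symm y' hy' u hu hxy' hzu
    have hyt := compl x hx w hw hwx.symm y hy t ht hxy hwt
    have hyt' := compl x hx w hw hwx.symm y' hy' t ht hxy' hwt
    have hut := compl z hz w hw hwz.symm u hu t ht hzu hwt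
    by_cases hyy : G.Adj y y'
    · exact hd.not_diamond hxy hxy' hyu.symm hyu'.symm hyy (uniq u hu z hz x hx hzx hzu)
        (by rintro rfl; exact hu hx)
    · exact hd.not_diamond hyu hyt hyu' hyt' hut hyy hne
  choose! n hn hadj using hout
  refine ⟨n, fun x hx => ⟨hn x hx, fun y hy => ⟨fun h => ?_, ?_⟩⟩, fun x hx x' hx' hne => ?_⟩
  · exact single x hx y hy _ (hn x hx) h (hadj x hx)
  · rintro rfl
    exact hadj x hx
  · exact compl x hx x' hx' hne _ (hn x hx) _ (hn x' hx') (hadj x hx) (hadj x' hx')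

/-- If `k` is at least the clique number and at most the minimum degree, then a maximum clique
with at least three vertices lies in a `k`-colorable union of components. -/
theorem IsIndFree.exists_coloring_of_clique [Fintype V] [DecidableRel G.Adj]
    (hb : IsIndFree G bull) (hd : IsIndFree G diamond)
    {k : ℕ} (hfree : G.CliqueFree (k + 1)) (hdeg : ∀ v, k ≤ G.degree v)
    (hclique : 3 ≤ G.cliqueNum) :
    ∃ (S : Set V) (f : V → Fin k), S.Nonempty ∧ (∀ u ∈ S, ∀ v, G.Adj u v → v ∈ S) ∧
      ∀ u ∈ S, ∀ v ∈ S, G.Adj u v → f u ≠ f v := by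
  classical
  have hle : ∀ s : Finset V, G.IsClique s → s.card ≤ k := by
    intro s hs
    by_contra! hlt
    exact hfree.mono hlt s ⟨hs, rfl⟩
  have hmaximal : ∀ s : Finset V, G.IsClique s → s.card = G.cliqueNum →
      ∀ v ∉ s, ∃ z ∈ s, ¬ G.Adj v z := by
    intro s hs hcard v hv
    by_contra! hcon
    have hins : G.IsClique (insert v s : Finset V) := by
      rw [Finset.coe_insert]
      exact hs.insert fun z hz _ => hcon z hz
    have := hins.card_le_cliqueNum
    rw [Finset.card_insert_of_notMem hv] at this
    omega
  obtain ⟨K, hK⟩ := G.exists_isNClique_cliqueNum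
  have hKk := hle K hK.isClique
  have hout : ∀ x ∈ K, ∃ y ∉ K, G.Adj x y := by
    intro x hx
    by_contra! hcon
    have hsub : G.neighborFinset x ⊆ K.erase x := by
      intro y hy
      rw [mem_neighborFinset] at hy
      exact Finset.mem_erase.2 ⟨hy.ne', by_contra fun h => hcon y h hy⟩
    have h1 := Finset.card_le_card hsub
    have h2 := Finset.card_erase_lt_of_mem hx
    have h3 := hdeg x
    rw [card_neighborFinset_eq_degree] at h1
    omega
  obtain ⟨n, hn, hnadj⟩ := hb.exists_private_neighbor hd hK.isClique (hK.card_eq ▸ hclique)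
    (hmaximal K hK.isClique hK.card_eq) hout
  have hninj : Set.InjOn n K := by
    intro x hx x' hx' h
    by_contra hne
    exact (hnadj x hx x' hx' hne).ne h
  obtain ⟨x₀, hx₀⟩ : K.Nonempty := Finset.card_pos.1 (by rw [hK.card_eq]; omega)
  have hk : K.card = k := by
    refine le_antisymm hKk ?_
    have hsub : G.neighborFinset x₀ ⊆ insert (n x₀) (K.erase x₀) := by
      intro y hy
      rw [mem_neighborFinset] at hy
      by_cases hyK : y ∈ K
      · exact Finset.mem_insert_of_mem (Finset.mem_erase.2 ⟨hy.ne', hyK⟩)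
      · rw [((hn x₀ hx₀).2 y hyK).1 hy]
        exact Finset.mem_insert_self _ _
    have h1 := Finset.card_le_card hsub
    have h2 := Finset.card_insert_le (n x₀) (K.erase x₀)
    have h3 := Finset.card_erase_add_one hx₀
    have h4 := hdeg x₀
    rw [card_neighborFinset_eq_degree] at h1
    omega
  have hNK : ∀ x ∈ K, x ∉ K.image n := by
    intro x hx h
    obtain ⟨x', hx', rfl⟩ := Finset.mem_image.1 h
    exact (hn x' hx').1 hx
  have hNcard : (K.image n).card = K.card := Finset.card_image_of_injOn hninj
  have hN : G.IsClique (K.image n : Finset V) := by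
    intro y hy y' hy' hne
    obtain ⟨x, hx, rfl⟩ := Finset.mem_image.1 hy
    obtain ⟨x', hx', rfl⟩ := Finset.mem_image.1 hy'
    exact hnadj x hx x' hx' fun h => hne (h ▸ rfl)
  have hadj : ∀ x ∈ K, G.Adj x (n x) := fun x hx => ((hn x hx).2 _ (hn x hx).1).2 rfl
  obtain ⟨m, hm, -⟩ := hb.exists_private_neighbor hd hN (by rw [hNcard, hK.card_eq]; exact hclique)
    (hmaximal _ hN (hNcard.trans hK.card_eq)) (by
      intro y hy
      obtain ⟨x, hx, rfl⟩ := Finset.mem_image.1 hy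
      exact ⟨x, hNK x hx, (hadj x hx).symm⟩)
  have hmn : ∀ x ∈ K, m (n x) = x := fun x hx =>
    (((hm (n x) (Finset.mem_image_of_mem n hx)).2 x (hNK x hx)).1 (hadj x hx).symm).symm
  have hk2 : 2 ≤ k := by have := hK.card_eq; omega
  obtain ⟨j, rfl⟩ : ∃ j, k = j + 2 := ⟨k - 2, by omega⟩
  obtain ⟨g, hg⟩ : ∃ g : V → Fin (j + 2), Set.InjOn g K := by
    refine ⟨fun v => if h : v ∈ K then K.equivFinOfCardEq hk ⟨v, h⟩ else 0, ?_⟩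
    intro x hx x' hx' h
    simp only [Finset.mem_coe] at hx hx'
    simpa [hx, hx'] using h
  have hmix : ∀ x ∈ K, ∀ x' ∈ K, G.Adj x (n x') → x = x' := by
    intro x hx x' hx' h
    exact hninj hx hx' (((hn x hx).2 _ (hn x' hx').1).1 h).symm
  refine ⟨{v | v ∈ K ∨ v ∈ K.image n}, fun v => if v ∈ K then g v else g (m v) + 1,
    ⟨x₀, .inl hx₀⟩, ?_, ?_⟩
  · rintro u (hu | hu) v huv
    · by_cases hv : v ∈ K
      · exact .inl hv
      · rw [((hn u hu).2 v hv).1 huv]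
        exact .inr (Finset.mem_image_of_mem n hu)
    · by_cases hv : v ∈ K.image n
      · exact .inr hv
      · rw [((hm u hu).2 v hv).1 huv]
        obtain ⟨x, hx, rfl⟩ := Finset.mem_image.1 hu
        rw [hmn x hx]
        exact .inl hx
  · rintro u (hu | hu) v (hv | hv) huv
    · simp only [hu, hv, if_true]
      exact fun h => huv.ne (hg hu hv h)
    · obtain ⟨x, hx, rfl⟩ := Finset.mem_image.1 hv
      obtain rfl := hmix u hu x hx huv
      simp [hu, (hn u hu).1, hmn u hu]
    · obtain ⟨x, hx, rfl⟩ := Finset.mem_image.1 hu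
      obtain rfl := hmix v hv x hx huv.symm
      simp [hv, (hn v hv).1, hmn v hv]
    · obtain ⟨x, hx, rfl⟩ := Finset.mem_image.1 hu
      obtain ⟨x', hx', rfl⟩ := Finset.mem_image.1 hv
      simp only [(hn x hx).1, (hn x' hx').1, if_false, hmn x hx, hmn x' hx']
      exact fun h => huv.ne (congrArg n (hg hx hx' (add_right_cancel h)))

theorem SimpleGraph.Colorable.of_induce_compl_of_degree_lt {k : ℕ} {v : V}
    [Fintype (G.neighborSet v)] (hv : G.degree v < k) (h : (G.induce {v}ᶜ).Colorable k) :
    G.Colorable k := by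
  classical
  obtain ⟨C⟩ := h
  let f : V → Fin k := fun u =>
    if h : u ∈ ({v}ᶜ : Set V) then C ⟨u, h⟩ else ⟨0, by omega⟩
  have hcard : ((G.neighborFinset v).image f).card < (Finset.univ : Finset (Fin k)).card := by
    rw [Finset.card_fin]
    exact Finset.card_image_le.trans_lt hv
  obtain ⟨i, -, hi⟩ := Finset.exists_mem_notMem_of_card_lt_card hcard
  have hi' : ∀ u, G.Adj v u → f u ≠ i := fun u hu h =>
    hi (Finset.mem_image.2 ⟨u, (mem_neighborFinset ..).2 hu, h⟩)
  have hf : ∀ u w, u ≠ v → w ≠ v → G.Adj u w → f u ≠ f w := by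
    intro u w hu hw huw
    have := C.valid (v := ⟨u, hu⟩) (w := ⟨w, hw⟩) huw
    simpa [f, hu, hw] using this
  refine ⟨Coloring.mk (fun u => if u = v then i else f u) ?_⟩
  intro u w huw
  have := huw.ne
  have := huw.symm
  grind

theorem SimpleGraph.Colorable.of_induce_compl_of_closed {α : Type*} {S : Set V} {f : V → α}
    (hS : ∀ u ∈ S, ∀ v, G.Adj u v → v ∈ S)
    (hf : ∀ u ∈ S, ∀ v ∈ S, G.Adj u v → f u ≠ f v) (h : Nonempty ((G.induce Sᶜ).Coloring α)) :
    Nonempty (G.Coloring α) := by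
  classical
  obtain ⟨C⟩ := h
  refine ⟨Coloring.mk (fun u => if h : u ∈ S then f u else C ⟨u, h⟩) ?_⟩
  intro u w huw
  by_cases hu : u ∈ S
  · have hw := hS u hu w huw
    simpa [hu, hw] using hf u hu w hw huw
  · have hw : w ∉ S := fun hw => hu (hS w hw u huw.symm)
    simpa [hu, hw] using C.valid (v := ⟨u, hu⟩) (w := ⟨w, hw⟩) huw

theorem IsIndFree.colorable_of_cliqueFree {k : ℕ} (hk : 3 ≤ k) [Finite V]
    (hc : IsIndFree G chair) (hb : IsIndFree G bull) (hd : IsIndFree G diamond)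
    (hfree : G.CliqueFree (k + 1)) : G.Colorable k := by
  classical
  induction hN : Nat.card V using Nat.strong_induction_on generalizing V with
  | _ N ih =>
  have := Fintype.ofFinite V
  subst hN
  have step : ∀ S : Set V, S.Nonempty → (G.induce Sᶜ).Colorable k := by
    rintro S ⟨v, hv⟩
    have e : G.induce Sᶜ ↪g G := Embedding.induce Sᶜ
    refine ih _ ?_ (hc.of_embedding e) (hb.of_embedding e) (hd.of_embedding e)
      (hfree.comap ⟨e.toCopy⟩) rfl
    exact Finite.card_subtype_lt (x := v) (by simpa using hv)
  by_cases hdeg : ∃ v, G.degree v < k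
  · obtain ⟨v, hv⟩ := hdeg
    exact .of_induce_compl_of_degree_lt hv (step _ (Set.singleton_nonempty v))
  push Not at hdeg
  rcases isEmpty_or_nonempty V with hV | ⟨⟨c⟩⟩
  · exact .of_isEmpty ..
  obtain ⟨S, f, hS, hclosed, hf⟩ : ∃ (S : Set V) (f : V → Fin k), S.Nonempty ∧
      (∀ u ∈ S, ∀ v, G.Adj u v → v ∈ S) ∧ ∀ u ∈ S, ∀ v ∈ S, G.Adj u v → f u ≠ f v := by
    by_cases hclique : 3 ≤ G.cliqueNum
    · exact hb.exists_coloring_of_clique hd hfree hdeg hclique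
    · have htri : ∀ a b c, G.Adj a b → G.Adj b c → ¬ G.Adj a c := by
        intro a b c hab hbc hac
        have h3 : G.IsNClique 3 {a, b, c} := is3Clique_triple_iff.2 ⟨hab, hac, hbc⟩
        exact hclique (h3.card_eq ▸ h3.isClique.card_le_cliqueNum)
      have hlt : 2 < (G.neighborFinset c).card := by
        rw [card_neighborFinset_eq_degree]
        have := hdeg c
        omega
      obtain ⟨p, q, r, hp, hq, hr, hpq, hpr, hqr⟩ := Finset.two_lt_card_iff.1 hlt
      rw [mem_neighborFinset] at hp hq hr
      obtain ⟨S, f, hS, h⟩ := hc.exists_two_coloring_of_chair htri hp hq hr hpq hpr hqr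
        (x := (⟨0, by omega⟩ : Fin k)) (y := ⟨1, by omega⟩) (by simp)
      exact ⟨S, f, ⟨c, hS⟩, h⟩
  exact Colorable.of_induce_compl_of_closed hclosed hf (step S hS)

end ChairBullDiamond

theorem statement_13 {V : Type*} [Fintype V] (G : SimpleGraph V)
    (hGc : IsIndFree G chair) (hGb : IsIndFree G bull)
    (hGd : IsIndFree G diamond) :
    G.chromaticNumber ≤ (max 6 G.cliqueNum : ℕ∞) := by
  have hfree : G.CliqueFree (max 6 G.cliqueNum + 1) := by
    intro s hs
    have h := hs.isClique.card_le_cliqueNum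
    rw [hs.card_eq] at h
    omega
  have h := (hGc.colorable_of_cliqueFree (by omega) hGb hGd hfree).chromaticNumber_le
  exact_mod_cast h
end

section
/- Let G be a connected finite simple graph that is bull-free and diamond-free with ω = ω(G) > 2, let K = {v_1, …, v_ω} be a maximum clique of G, and suppose G is not isomorphic to a subgraph of K_ω □ K_2 (i.e., there is no injective graph homomorphism from G into K_ω □ K_2). Then there exist indices i, j ∈ {1, …, ω} such that N_1(K) = W_K(i) ∪ W_K(j); moreover, if N_1(K) = W_K(i) or N_1(K) = W_K(j), then every connected component of the subgraph of G induced by N_1(K) is a complete graph, and otherwise the subgraph of G induced by N_1(K) is a complete bipartite graph with bipartition (W_K(i), W_K(j)). -/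
open SimpleGraph

/-- Distance from a vertex `x` to a set `K` of vertices. -/
noncomputable def distToSet {V : Type*} (G : SimpleGraph V) (x : V) (K : Set V) : ℕ :=
  sInf ((G.dist x) '' K)

/-- `N_i(K)`: the set of vertices at distance exactly `i` from `K`. -/
def levelSet {V : Type*} (G : SimpleGraph V) (K : Set V) (i : ℕ) : Set V :=
  {x | distToSet G x K = i}

/-- `W_K(u)`: vertices outside `K` whose neighbourhood meets `K` exactly in `{u}`. -/
def Wside {V : Type*} (G : SimpleGraph V) (K : Set V) (u : V) : Set V :=
  {x | x ∉ K ∧ G.neighborSet x ∩ K = {u}}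

theorem IsIndFree.false_of_injective {V W : Type*} {G : SimpleGraph V} {H : SimpleGraph W}
    (h : IsIndFree G H) (f : W → V) (hf : Function.Injective f)
    (hadj : ∀ i j, G.Adj (f i) (f j) ↔ H.Adj i j) : False :=
  h _ ⟨SimpleGraph.Embedding.isoInduceRange ⟨⟨f, hf⟩, hadj _ _⟩⟩

/-- In a diamond-free graph, two distinct common neighbours of an edge are adjacent. -/
theorem IsIndFree.adj_of_diamond_s14 {V : Type*} {G : SimpleGraph V} (h : IsIndFree G diamond)
    {a b c d : V} (hab : a ≠ b) (hac : G.Adj a c) (had : G.Adj a d) (hbc : G.Adj b c)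
    (hbd : G.Adj b d) (hcd : G.Adj c d) : G.Adj a b := by
  by_contra hn
  have hn' : ¬ G.Adj b a := fun h => hn h.symm
  refine h.false_of_injective ![a, b, c, d] ?_ ?_
  · intro i j hij
    fin_cases i <;> fin_cases j <;>
      simp_all [hac.ne, had.ne, hbc.ne, hbd.ne, hcd.ne, hac.ne', had.ne', hbc.ne', hbd.ne', hcd.ne',
        hab.symm]
  · intro i j
    fin_cases i <;> fin_cases j <;>
      simp [diamond, hn, hn', hac, had, hbc, hbd, hcd, hac.symm, had.symm, hbc.symm, hbd.symm,
        hcd.symm]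

/-- The five vertices of a potential bull with triangle `a b c` and pendant edges `b d`, `c e`
span a further edge in a bull-free graph. -/
theorem IsIndFree.adj_of_bull_s14 {V : Type*} {G : SimpleGraph V} (h : IsIndFree G bull)
    {a b c d e : V} (hab : G.Adj a b) (hbc : G.Adj b c) (hac : G.Adj a c) (hbd : G.Adj b d)
    (hce : G.Adj c e) (had : ¬ G.Adj a d) (hae : ¬ G.Adj a e) (hbe : ¬ G.Adj b e)
    (hcd : ¬ G.Adj c d) : G.Adj d e := by
  by_contra hde
  have n1 : a ≠ d := by rintro rfl; exact hcd hac.symm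
  have n2 : a ≠ e := by rintro rfl; exact hbe hab.symm
  have n3 : b ≠ e := by rintro rfl; exact hae hab
  have n4 : c ≠ d := by rintro rfl; exact had hac
  have n5 : d ≠ e := by rintro rfl; exact hbe hbd
  refine h.false_of_injective ![a, b, c, d, e] ?_ ?_
  · intro i j hij
    fin_cases i <;> fin_cases j <;>
      simp_all [hab.ne, hbc.ne, hac.ne, hbd.ne, hce.ne, hab.ne', hbc.ne', hac.ne', hbd.ne',
        hce.ne', n1.symm, n2.symm, n3.symm, n4.symm, n5.symm]
  · intro i j
    fin_cases i <;> fin_cases j <;>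
      simp [bull, hab, hbc, hac, hbd, hce, had, hae, hbe, hcd, hde, hab.symm, hbc.symm, hac.symm,
        hbd.symm, hce.symm, mt G.adj_symm had, mt G.adj_symm hae, mt G.adj_symm hbe,
        mt G.adj_symm hcd, mt G.adj_symm hde]

/-- A partial injection into a set of sufficient size extends to an injection. -/
theorem exists_injective_extend {B : Type*} [Finite B] {n : ℕ} (hB : Nat.card B ≤ n) (s : Set B)
    (f : B → Fin n) (hf : Set.InjOn f s) :
    ∃ e : B → Fin n, Function.Injective e ∧ ∀ x ∈ s, e x = f x := by
  classical
  have := Fintype.ofFinite B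
  rw [Nat.card_eq_fintype_card] at hB
  obtain ⟨t, hst, -, ht⟩ := Finset.exists_subsuperset_card_eq (s := s.toFinset.image f)
    (t := Finset.univ) (n := Fintype.card B) (Finset.subset_univ _)
    (Finset.card_image_le.trans (Finset.card_le_univ _)) (by simpa using hB)
  obtain ⟨g, hg⟩ := Finset.exists_equiv_extend_of_card_eq ht.symm hst (by simpa using hf)
  exact ⟨fun x => g x, Subtype.val_injective.comp g.injective, fun x hx => hg x (by simpa using hx)⟩

theorem mem_levelSet_one_iff {V : Type*} {G : SimpleGraph V} (hconn : G.Connected) {K : Set V}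
    (hK : K.Nonempty) {x : V} : x ∈ levelSet G K 1 ↔ x ∉ K ∧ ∃ u ∈ K, G.Adj x u := by
  have hne : (G.dist x '' K).Nonempty := hK.image _
  simp only [levelSet, distToSet, Set.mem_ofPred_eq]
  constructor
  · intro h
    obtain ⟨u, hu, hxu⟩ := Nat.sInf_mem hne
    refine ⟨fun hx => ?_, u, hu, SimpleGraph.dist_eq_one_iff_adj.mp (hxu.trans h)⟩
    have := Nat.sInf_le (Set.mem_image_of_mem (G.dist x) hx)
    rw [h, SimpleGraph.dist_self] at this
    omega
  · rintro ⟨hx, u, hu, hxu⟩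
    have h1 := Nat.sInf_le (Set.mem_image_of_mem (G.dist x) hu)
    rw [SimpleGraph.dist_eq_one_iff_adj.mpr hxu] at h1
    obtain ⟨w, hw, hxw⟩ := Nat.sInf_mem hne
    have : G.dist x w ≠ 0 := fun h => hx ((hconn.dist_eq_zero_iff.mp h) ▸ hw)
    omega

section

variable {V : Type*} {G : SimpleGraph V} {n : ℕ} {v : Fin n → V}

/-- A graph covered by two cliques, one of them `v`, with a matching between them, embeds into
`K_n □ K_2`. -/
theorem exists_injective_hom_boxProd [Finite V] [Nonempty (Fin n)] (hv : Function.Injective v)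
    (hB : Nat.card {x // x ∉ Set.range v} ≤ n)
    (huniq : ∀ x ∉ Set.range v, ∀ i j, G.Adj x (v i) → G.Adj x (v j) → i = j)
    (hinj : ∀ x ∉ Set.range v, ∀ y ∉ Set.range v, ∀ k, G.Adj x (v k) → G.Adj y (v k) → x = y) :
    ∃ f : G →g (completeGraph (Fin n) □ completeGraph (Fin 2)), Function.Injective f := by
  classical
  obtain ⟨e, he, hext⟩ := exists_injective_extend hB {x | ∃ k, G.Adj x (v k)}
    (fun x => if h : ∃ k, G.Adj x (v k) then h.choose else Classical.arbitrary _) (by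
      rintro ⟨x, hx⟩ hxk ⟨y, hy⟩ hyk hxy
      simp only [Set.mem_ofPred_eq] at hxk hyk
      simp only [hxk, hyk, dite_true] at hxy
      have h1 := hxk.choose_spec
      rw [hxy] at h1
      exact Subtype.ext (hinj x hx y hy _ h1 hyk.choose_spec))
  have hext' : ∀ (x : {x // x ∉ Set.range v}) k, G.Adj x (v k) → e x = k := by
    intro x k hk
    have h : ∃ k, G.Adj x (v k) := ⟨k, hk⟩
    rw [hext x h, dif_pos h]
    exact huniq x x.2 _ _ h.choose_spec hk
  let F : V → Fin n × Fin 2 := fun x =>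
    if h : x ∈ Set.range v then (h.choose, 0) else (e ⟨x, h⟩, 1)
  have hF0 : ∀ i, F (v i) = (i, 0) := by
    intro i
    have h : v i ∈ Set.range v := ⟨i, rfl⟩
    simp only [F, dif_pos h]
    rw [hv h.choose_spec]
  have hF1 : ∀ x (h : x ∉ Set.range v), F x = (e ⟨x, h⟩, 1) := fun x h => by simp only [F, dif_neg h]
  refine ⟨⟨F, ?_⟩, ?_⟩
  · intro x y hxy
    rw [SimpleGraph.boxProd_adj]
    by_cases hx : x ∈ Set.range v <;> by_cases hy : y ∈ Set.range v
    · obtain ⟨i, rfl⟩ := hx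
      obtain ⟨j, rfl⟩ := hy
      rw [hF0, hF0]
      left
      exact ⟨fun h => hxy.ne (congrArg v h), rfl⟩
    · obtain ⟨i, rfl⟩ := hx
      rw [hF0, hF1 y hy]
      right
      exact ⟨by simp, (hext' ⟨y, hy⟩ i hxy.symm).symm⟩
    · obtain ⟨i, rfl⟩ := hy
      rw [hF0, hF1 x hx]
      right
      exact ⟨by simp, hext' ⟨x, hx⟩ i hxy⟩
    · rw [hF1 x hx, hF1 y hy]
      left
      exact ⟨fun h => hxy.ne (congrArg Subtype.val (he h)), rfl⟩
  · intro x y hxy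
    change F x = F y at hxy
    by_cases hx : x ∈ Set.range v <;> by_cases hy : y ∈ Set.range v
    · obtain ⟨i, rfl⟩ := hx
      obtain ⟨j, rfl⟩ := hy
      rw [hF0, hF0] at hxy
      exact congrArg v (Prod.ext_iff.mp hxy).1
    · obtain ⟨i, rfl⟩ := hx
      rw [hF0, hF1 y hy] at hxy
      simp at hxy
    · obtain ⟨i, rfl⟩ := hy
      rw [hF0, hF1 x hx] at hxy
      simp at hxy
    · rw [hF1 x hx, hF1 y hy] at hxy
      exact congrArg Subtype.val (he (Prod.ext_iff.mp hxy).1)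

variable (hGb : IsIndFree G bull) (hGd : IsIndFree G diamond)

include hGd in
theorem eq_of_adj_of_adj_clique (hcl : ∀ i j, i ≠ j → G.Adj (v i) (v j))
    (hmax : ∀ x ∉ Set.range v, ∃ k, ¬ G.Adj x (v k))
    {x : V} (hx : x ∉ Set.range v) {i j : Fin n} (hi : G.Adj x (v i)) (hj : G.Adj x (v j)) :
    i = j := by
  by_contra hij
  obtain ⟨k, hk⟩ := hmax x hx
  have hki : k ≠ i := by rintro rfl; exact hk hi
  have hkj : k ≠ j := by rintro rfl; exact hk hj
  exact hk (hGd.adj_of_diamond_s14 (fun h => hx ⟨k, h.symm⟩) hi hj (hcl _ _ hki) (hcl _ _ hkj)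
    (hcl _ _ hij))

include hGb in
theorem adj_of_adj_clique_of_ne (hcl : ∀ i j, i ≠ j → G.Adj (v i) (v j)) (hn : 2 < n)
    (huniq : ∀ x ∉ Set.range v, ∀ i j, G.Adj x (v i) → G.Adj x (v j) → i = j)
    {x y : V} (hx : x ∉ Set.range v) (hy : y ∉ Set.range v) {i j : Fin n} (hij : i ≠ j)
    (hi : G.Adj x (v i)) (hj : G.Adj y (v j)) : G.Adj x y := by
  obtain ⟨k, hk⟩ : ∃ k, k ∉ ({i, j} : Finset (Fin n)) := by
    by_contra! h
    have := (Finset.card_le_card (fun a _ => h a : Finset.univ ⊆ _)).trans Finset.card_le_two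
    simp at this
    omega
  simp only [Finset.mem_insert, Finset.mem_singleton, not_or] at hk
  exact hGb.adj_of_bull_s14 (hcl k i hk.1) (hcl i j hij) (hcl k j hk.2) hi.symm hj.symm
    (fun h => hk.1 (huniq x hx _ _ h.symm hi)) (fun h => hk.2 (huniq y hy _ _ h.symm hj))
    (fun h => hij (huniq y hy _ _ h.symm hj)) (fun h => hij (huniq x hx _ _ hi h.symm))

include hGb hGd in
/-- A vertex attached to one vertex `p` of a triangle `p q r` is adjacent to `q`, provided `q` has a
further neighbour `u` that is not adjacent to the other vertices. -/
theorem adj_of_triangle_of_pendant {w p q r u : V} (hpq : G.Adj p q) (hpr : G.Adj p r)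
    (hqr : G.Adj q r) (hwp : G.Adj w p) (hqu : G.Adj q u) (hpu : ¬ G.Adj p u) (hru : ¬ G.Adj r u)
    (hwu : ¬ G.Adj w u) (hwq : w ≠ q) : G.Adj w q := by
  by_contra h
  by_cases hwr : G.Adj w r
  · exact h (hGd.adj_of_diamond_s14 hwq hwp hwr hpq.symm hqr hpr)
  · exact hwu (hGb.adj_of_bull_s14 hpr.symm hpq hqr.symm hwp.symm hqu (fun h => hwr h.symm) hru hpu
      (fun h' => h h'.symm))

include hGb hGd in
/-- If at least three vertices of the maximum clique `v` have private neighbours `x₁`, `x₂`, `x₃`,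
then every vertex outside the clique is equal or adjacent to each of these. -/
theorem forall_eq_or_adj_of_three_private (hconn : G.Connected)
    (huniq : ∀ x ∉ Set.range v, ∀ i j, G.Adj x (v i) → G.Adj x (v j) → i = j)
    (hcross : ∀ x ∉ Set.range v, ∀ y ∉ Set.range v, ∀ i j, i ≠ j → G.Adj x (v i) → G.Adj y (v j) →
      G.Adj x y)
    (x : Fin 3 → V) (i : Fin 3 → Fin n) (hi : Function.Injective i)
    (hx : ∀ a, x a ∉ Set.range v) (hxi : ∀ a, G.Adj (x a) (v (i a))) :
    ∀ y ∉ Set.range v, ∀ a, y = x a ∨ G.Adj y (x a) := by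
  have hxx : ∀ a b, a ≠ b → G.Adj (x a) (x b) := fun a b hab =>
    hcross _ (hx a) _ (hx b) _ _ (fun h => hab (hi h)) (hxi a) (hxi b)
  have third : ∀ a : Fin 3, ∃ b c : Fin 3, a ≠ b ∧ a ≠ c ∧ b ≠ c := by decide
  have hxv : ∀ a b, a ≠ b → ¬ G.Adj (x a) (v (i b)) := fun a b hab h =>
    hab (hi (huniq _ (hx a) _ _ (hxi a) h))
  have hN1 : ∀ y ∉ Set.range v, ∀ k, G.Adj y (v k) → ∀ a, y = x a ∨ G.Adj y (x a) := by
    intro y hy k hk a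
    by_cases hka : k = i a
    · subst hka
      obtain ⟨b, c, hab, hac, hbc⟩ := third a
      by_cases hya : y = x a
      · exact Or.inl hya
      · exact Or.inr (hGd.adj_of_diamond_s14 hya
          (hcross y hy _ (hx b) _ _ (fun h => hab (hi h)) hk (hxi b))
          (hcross y hy _ (hx c) _ _ (fun h => hac (hi h)) hk (hxi c))
          (hxx a b hab) (hxx a c hac) (hxx b c hbc))
    · exact Or.inr (hcross y hy _ (hx a) _ _ hka hk (hxi a))
  have hstep : ∀ y w, (y ∈ Set.range v ∨ ∀ a, y = x a ∨ G.Adj y (x a)) → G.Adj y w →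
      (w ∈ Set.range v ∨ ∀ a, w = x a ∨ G.Adj w (x a)) := by
    intro y w hy hyw
    by_cases hw : w ∈ Set.range v
    · exact Or.inl hw
    right
    by_cases hwk : ∃ k, G.Adj w (v k)
    · exact hN1 w hw _ hwk.choose_spec
    push Not at hwk
    have hyv : y ∉ Set.range v := by
      rintro ⟨k, rfl⟩
      exact hwk k hyw.symm
    replace hy := hy.resolve_left (fun h => hyv h)
    intro a
    by_contra! hcon
    obtain ⟨hwa, hwa'⟩ := hcon
    have hya : y ≠ x a := by rintro rfl; exact hwa' hyw.symm
    have hyadj := (hy a).resolve_left hya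
    obtain ⟨b, hab, hyb, hyb'⟩ : ∃ b, a ≠ b ∧ y ≠ x b ∧ G.Adj y (x b) := by
      obtain ⟨b, c, hab, hac, hbc⟩ := third a
      by_cases hyb : y = x b
      · exact ⟨c, hac, fun h => (hxx b c hbc).ne (hyb ▸ h), hyb ▸ hxx b c hbc⟩
      · exact ⟨b, hab, hyb, (hy b).resolve_left hyb⟩
    have hyia : ¬ G.Adj y (v (i a)) := by
      intro h
      exact hxv b a hab.symm (hGd.adj_of_diamond_s14 (fun h' => hx b ⟨_, h'.symm⟩) hyb'.symm
        (hxx a b hab).symm h.symm (hxi a).symm hyadj)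
    exact hwa' (adj_of_triangle_of_pendant hGb hGd hyadj hyb' (hxx a b hab) hyw.symm (hxi a) hyia
      (hxv b a hab.symm) (hwk _) hwa)
  have hall : ∀ y, y ∈ Set.range v ∨ ∀ a, y = x a ∨ G.Adj y (x a) := by
    intro y
    have : ∀ z (p : G.Walk z y), (z ∈ Set.range v ∨ ∀ a, z = x a ∨ G.Adj z (x a)) →
        (y ∈ Set.range v ∨ ∀ a, y = x a ∨ G.Adj y (x a)) := by
      intro z p
      induction p with
      | nil => exact id
      | cons h _ ih => exact fun hz => ih (hstep _ _ hz h)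
    obtain ⟨p⟩ := hconn.preconnected (v (i 0)) y
    exact this _ p (Or.inl ⟨_, rfl⟩)
  exact fun y hy => (hall y).resolve_left hy

end

theorem statement_14 {V : Type*} [Fintype V] [DecidableEq V] (G : SimpleGraph V)
    (hconn : G.Connected) (hGb : IsIndFree G bull) (hGd : IsIndFree G diamond)
    (hw : 2 < G.cliqueNum)
    (v : Fin G.cliqueNum → V) (hv : Function.Injective v)
    (hK : G.IsMaximumClique (Finset.univ.image v))
    (hsub : ¬ ∃ f : G →g (completeGraph (Fin G.cliqueNum) □ completeGraph (Fin 2)),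
      Function.Injective f) :
    ∃ i j : Fin G.cliqueNum,
      levelSet G (Set.range v) 1
          = Wside G (Set.range v) (v i) ∪ Wside G (Set.range v) (v j) ∧
      ((levelSet G (Set.range v) 1 = Wside G (Set.range v) (v i) ∨
          levelSet G (Set.range v) 1 = Wside G (Set.range v) (v j)) →
        ∀ x y : ↥(levelSet G (Set.range v) 1),
          (G.induce (levelSet G (Set.range v) 1)).Reachable x y →
            x = y ∨ (G.induce (levelSet G (Set.range v) 1)).Adj x y) ∧
      (¬ (levelSet G (Set.range v) 1 = Wside G (Set.range v) (v i) ∨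
          levelSet G (Set.range v) 1 = Wside G (Set.range v) (v j)) →
        (∀ x ∈ Wside G (Set.range v) (v i), ∀ y ∈ Wside G (Set.range v) (v j), G.Adj x y) ∧
        (∀ x ∈ Wside G (Set.range v) (v i), ∀ y ∈ Wside G (Set.range v) (v i), ¬ G.Adj x y) ∧
        (∀ x ∈ Wside G (Set.range v) (v j), ∀ y ∈ Wside G (Set.range v) (v j), ¬ G.Adj x y)) := by
  classical
  have hrange : ∀ x, x ∉ Set.range v ↔ x ∉ Finset.univ.image v := by simp
  have hcl : ∀ i j, i ≠ j → G.Adj (v i) (v j) := fun i j hij =>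
    hK.isClique (by simp) (by simp) (fun h => hij (hv h))
  have hmax : ∀ x ∉ Set.range v, ∃ k, ¬ G.Adj x (v k) := by
    intro x hx
    by_contra! h
    have h1 : G.IsClique (insert x (Finset.univ.image v) : Finset V) := by
      rw [Finset.coe_insert, SimpleGraph.isClique_insert]
      refine ⟨hK.isClique, fun b hb _ => ?_⟩
      obtain ⟨k, rfl⟩ : ∃ k, v k = b := by simpa using hb
      exact h k
    have h2 := hK.maximum _ h1
    rw [Finset.card_insert_of_notMem ((hrange x).mp hx)] at h2
    omega
  have huniq : ∀ x ∉ Set.range v, ∀ i j, G.Adj x (v i) → G.Adj x (v j) → i = j :=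
    fun x hx i j => eq_of_adj_of_adj_clique hGd hcl hmax hx
  have hcross : ∀ x ∉ Set.range v, ∀ y ∉ Set.range v, ∀ i j, i ≠ j → G.Adj x (v i) →
      G.Adj y (v j) → G.Adj x y :=
    fun x hx y hy i j hij => adj_of_adj_clique_of_ne hGb hcl hw huniq hx hy hij
  have hmemW : ∀ x k, x ∈ Wside G (Set.range v) (v k) ↔ x ∉ Set.range v ∧ G.Adj x (v k) := by
    intro x k
    refine and_congr_right fun hx => ⟨fun h => ?_, fun h => ?_⟩
    · exact (h.symm ▸ Set.mem_singleton (v k) : v k ∈ G.neighborSet x ∩ Set.range v).1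
    · ext u
      constructor
      · rintro ⟨hu, j, rfl⟩
        exact congrArg v (huniq x hx _ _ hu h)
      · rintro rfl
        exact ⟨h, k, rfl⟩
  have hmemN : ∀ x, x ∈ levelSet G (Set.range v) 1 ↔ x ∉ Set.range v ∧ ∃ k, G.Adj x (v k) := by
    intro x
    rw [mem_levelSet_one_iff hconn ⟨v ⟨0, by omega⟩, Set.mem_range_self _⟩]
    simp
  have hindep : ∀ i j, i ≠ j → ∀ z ∉ Set.range v, G.Adj z (v j) → ∀ x ∉ Set.range v,
      ∀ y ∉ Set.range v, G.Adj x (v i) → G.Adj y (v i) → ¬ G.Adj x y := by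
    intro i j hij z hz hzj x hx y hy hxi hyi hxy
    refine hij (huniq z hz _ _ ?_ hzj)
    exact (hGd.adj_of_diamond_s14 (fun h => hz ⟨i, h⟩) hxi.symm hyi.symm
      (hcross x hx z hz i j hij hxi hzj).symm (hcross y hy z hz i j hij hyi hzj).symm hxy).symm
  have hthree : ∀ i : Fin 3 → Fin G.cliqueNum, Function.Injective i →
      ¬ ∀ a, ∃ x ∉ Set.range v, G.Adj x (v (i a)) := by
    intro i hi hex
    choose x hx hxi using hex
    have hall := forall_eq_or_adj_of_three_private hGb hGd hconn huniq hcross x i hi hx hxi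
    have hBcl : ∀ y ∉ Set.range v, ∀ z ∉ Set.range v, y ≠ z → G.Adj y z := by
      intro y hy z hz hyz
      have key : ∀ a, y = x a ∨ z = x a → G.Adj y z := by
        rintro a (rfl | rfl)
        · exact ((hall z hz a).resolve_left hyz.symm).symm
        · exact (hall y hy a).resolve_left hyz
      by_contra hn
      have hy' : ∀ a, G.Adj y (x a) := fun a =>
        (hall y hy a).resolve_left fun h => hn (key a (Or.inl h))
      have hz' : ∀ a, G.Adj z (x a) := fun a =>
        (hall z hz a).resolve_left fun h => hn (key a (Or.inr h))
      exact hn (hGd.adj_of_diamond_s14 hyz (hy' 0) (hy' 1) (hz' 0) (hz' 1)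
        (hcross _ (hx 0) _ (hx 1) _ _ (fun h => by simpa using hi h) (hxi 0) (hxi 1)))
    have : Nonempty (Fin G.cliqueNum) := ⟨i 0⟩
    refine hsub (exists_injective_hom_boxProd hv ?_ huniq ?_)
    · have h1 : G.IsClique ((Finset.univ.image v)ᶜ : Finset V) := by
        intro y hy z hz hyz
        exact hBcl y (by simpa using hy) z (by simpa using hz) hyz
      have h2 := h1.card_le_cliqueNum
      rw [Nat.card_eq_fintype_card, Fintype.card_subtype]
      convert h2 using 2
      ext y
      simp
    · intro y hy z hz k hyk hzk
      by_contra hyz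
      obtain ⟨a, ha⟩ : ∃ a, k ≠ i a := by
        by_contra! h
        have := hi ((h 0).symm.trans (h 1))
        simp at this
      exact hindep k (i a) ha (x a) (hx a) (hxi a) y hy z hz hyk hzk (hBcl y hy z hz hyz)
  obtain ⟨i, j, hcover⟩ : ∃ i j, ∀ k, (∃ x ∉ Set.range v, G.Adj x (v k)) → k = i ∨ k = j := by
    by_contra! h
    obtain ⟨a, ha, -⟩ := h ⟨0, by omega⟩ ⟨0, by omega⟩
    obtain ⟨b, hb, hba, -⟩ := h a a
    obtain ⟨c, hc, hca, hcb⟩ := h a b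
    refine hthree ![a, b, c] ?_ ?_
    · intro p q
      fin_cases p <;> fin_cases q <;> simp [hba, hca, hcb, hba.symm, hca.symm, hcb.symm]
    · intro p
      fin_cases p
      exacts [ha, hb, hc]
  have hNeq : levelSet G (Set.range v) 1
      = Wside G (Set.range v) (v i) ∪ Wside G (Set.range v) (v j) := by
    ext x
    rw [Set.mem_union, hmemN, hmemW, hmemW]
    constructor
    · rintro ⟨hx, k, hk⟩
      rcases hcover k ⟨x, hx, hk⟩ with rfl | rfl
      exacts [Or.inl ⟨hx, hk⟩, Or.inr ⟨hx, hk⟩]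
    · rintro (⟨hx, hk⟩ | ⟨hx, hk⟩)
      exacts [⟨hx, _, hk⟩, ⟨hx, _, hk⟩]
  have hcomp : ∀ k, levelSet G (Set.range v) 1 = Wside G (Set.range v) (v k) →
      ∀ x y : ↥(levelSet G (Set.range v) 1),
        (G.induce (levelSet G (Set.range v) 1)).Reachable x y →
          x = y ∨ (G.induce (levelSet G (Set.range v) 1)).Adj x y := by
    rintro k hk x y ⟨p⟩
    have hadj : ∀ z : ↥(levelSet G (Set.range v) 1), G.Adj z (v k) := fun z =>
      ((hmemW _ _).mp (hk ▸ z.2)).2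
    induction p with
    | nil => exact Or.inl rfl
    | @cons a b c hab _ ih =>
      rcases ih with rfl | hbc
      · exact Or.inr hab
      by_cases hac : a = c
      · exact Or.inl hac
      · right
        simp only [SimpleGraph.comap_adj, Function.Embedding.subtype_apply] at hab hbc ⊢
        exact hGd.adj_of_diamond_s14 (fun h => hac (Subtype.ext h)) hab (hadj a) hbc.symm (hadj c)
          (hadj b)
  refine ⟨i, j, hNeq, ?_, ?_⟩
  · rintro (h | h)
    exacts [hcomp i h, hcomp j h]
  · intro h
    rw [not_or] at h
    have hij : i ≠ j := by
      rintro rfl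
      exact h.1 (by rw [hNeq, Set.union_self])
    have hi : (Wside G (Set.range v) (v i)).Nonempty := by
      rw [Set.nonempty_iff_ne_empty]
      intro h0
      exact h.2 (by rw [hNeq, h0, Set.empty_union])
    have hj : (Wside G (Set.range v) (v j)).Nonempty := by
      rw [Set.nonempty_iff_ne_empty]
      intro h0
      exact h.1 (by rw [hNeq, h0, Set.union_empty])
    obtain ⟨p, hp⟩ := hi
    obtain ⟨q, hq⟩ := hj
    simp only [hmemW] at hp hq ⊢
    exact ⟨fun x hx y hy => hcross x hx.1 y hy.1 i j hij hx.2 hy.2,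
      fun x hx y hy => hindep i j hij q hq.1 hq.2 x hx.1 y hy.1 hx.2 hy.2,
      fun x hx y hy => hindep j i hij.symm p hp.1 hp.2 x hx.1 y hy.1 hx.2 hy.2⟩
end

section
/- Let G be a connected finite simple graph that is bull-free and diamond-free with ω = ω(G) > 2, let K be a maximum clique of G, and suppose G is not isomorphic to a subgraph of K_ω □ K_2 (i.e., there is no injective graph homomorphism from G into K_ω □ K_2). Let i ≥ 2 and let G' be a connected component of the subgraph of G induced by N_i(K) that contains a triangle. Then no vertex of G' has a neighbour in N_{i+1}(K). -/
open SimpleGraph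

section InducedSubgraphs

variable {V W : Type*} {G : SimpleGraph V} {H : SimpleGraph W}

/-- In a bull-free graph, pendant vertices at two corners of a triangle are adjacent. -/
theorem IsIndFree.adj_of_pendants (h : IsIndFree G bull) {a b c x y : V}
    (hab : G.Adj a b) (hac : G.Adj a c) (hbc : G.Adj b c)
    (hxa : G.Adj x a) (hyb : G.Adj y b) (hxb : ¬ G.Adj x b) (hxc : ¬ G.Adj x c)
    (hya : ¬ G.Adj y a) (hyc : ¬ G.Adj y c) : G.Adj x y := by
  by_contra hxy
  have hf : Function.Injective ![c, a, b, x, y] := by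
    intro i j hij
    fin_cases i <;> fin_cases j <;> simp at hij ⊢ <;> subst hij <;>
      simp_all [G.adj_comm]
  refine h.isEmpty_embedding.false ⟨⟨![c, a, b, x, y], hf⟩, ?_⟩
  intro i j
  fin_cases i <;> fin_cases j <;> simp [bull] <;> simp_all [G.adj_comm]

/-- In a diamond-free graph, two common neighbours of an edge are equal or adjacent. -/
theorem IsIndFree.adj_of_common_neighbors (h : IsIndFree G diamond) {a b c d : V}
    (hab : G.Adj a b) (hac : G.Adj a c) (hbc : G.Adj b c)
    (had : G.Adj a d) (hbd : G.Adj b d) (hne : c ≠ d) : G.Adj c d := by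
  by_contra hcd
  have hf : Function.Injective ![c, d, a, b] := by
    intro i j hij
    fin_cases i <;> fin_cases j <;> simp at hij ⊢ <;> subst hij <;>
      simp_all [G.adj_comm]
  refine h.isEmpty_embedding.false ⟨⟨![c, d, a, b], hf⟩, ?_⟩
  intro i j
  fin_cases i <;> fin_cases j <;> simp [diamond] <;> simp_all [G.adj_comm]

/-- A vertex outside a maximum clique of a diamond-free graph has at most one neighbour in it. -/
theorem SimpleGraph.IsMaximumClique.not_adj_of_adj [Fintype V] [DecidableEq V] {K : Finset V}
    (hK : G.IsMaximumClique K) (hGd : IsIndFree G diamond) {p q k : V} (hp : p ∉ K)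
    (hq : q ∈ K) (hk : k ∈ K) (hqk : q ≠ k) (hpq : G.Adj p q) : ¬ G.Adj p k := by
  intro hpk
  have hall : ∀ r ∈ K, G.Adj p r := by
    intro r hr
    by_cases hrq : r = q
    · exact hrq ▸ hpq
    by_cases hrk : r = k
    · exact hrk ▸ hpk
    have hc := hK.isClique
    exact hGd.adj_of_common_neighbors (hc hq hk hqk) hpq.symm hpk.symm
      (hc hq hr (Ne.symm hrq)) (hc hk hr (Ne.symm hrk)) (fun h => hp (h ▸ hr))
  have hins : G.IsClique (insert p K : Finset V) := by
    rw [Finset.coe_insert]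
    exact hK.isClique.insert fun r hr _ => hall r hr
  have hle := hK.maximum _ hins
  rw [Finset.card_insert_of_notMem hp] at hle
  omega

end InducedSubgraphs

section Levels

variable {V : Type*} {G : SimpleGraph V} {K : Set V}

theorem distToSet_le {x k : V} (hk : k ∈ K) : distToSet G x K ≤ G.dist x k :=
  Nat.sInf_le ⟨k, hk, rfl⟩

theorem exists_dist_eq_distToSet (hne : K.Nonempty) (x : V) :
    ∃ k ∈ K, G.dist x k = distToSet G x K :=
  Nat.sInf_mem (hne.image (G.dist x))

theorem distToSet_eq_zero_iff (hconn : G.Connected) (hne : K.Nonempty) {x : V} :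
    distToSet G x K = 0 ↔ x ∈ K := by
  constructor
  · intro h
    obtain ⟨k, hk, hd⟩ := exists_dist_eq_distToSet (G := G) hne x
    rw [h, hconn.dist_eq_zero_iff] at hd
    exact hd ▸ hk
  · intro h
    simpa using distToSet_le (G := G) (x := x) h

theorem distToSet_le_add_one (hconn : G.Connected) (hne : K.Nonempty) {x y : V}
    (hxy : G.Adj x y) : distToSet G x K ≤ distToSet G y K + 1 := by
  obtain ⟨k, hk, hd⟩ := exists_dist_eq_distToSet (G := G) hne y
  have h₁ : distToSet G x K ≤ G.dist x k := distToSet_le hk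
  have h₂ : G.dist x k ≤ G.dist x y + G.dist y k := hconn.dist_triangle
  have h₃ : G.dist x y = 1 := dist_eq_one_iff_adj.mpr hxy
  omega

theorem not_adj_of_distToSet_lt (hconn : G.Connected) (hne : K.Nonempty) {x y : V}
    (h : distToSet G x K + 1 < distToSet G y K) : ¬ G.Adj x y := fun hxy => by
  have := distToSet_le_add_one hconn hne hxy.symm
  omega

theorem exists_adj_distToSet_eq (hconn : G.Connected) (hne : K.Nonempty) {x : V} {n : ℕ}
    (hx : distToSet G x K = n + 1) : ∃ y, G.Adj y x ∧ distToSet G y K = n := by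
  obtain ⟨k, hk, hd⟩ := exists_dist_eq_distToSet (G := G) hne x
  obtain ⟨w, hw⟩ := hconn.exists_walk_length_eq_dist x k
  cases w with
  | nil =>
    rw [dist_self] at hd
    omega
  | @cons _ y _ hxy w =>
    refine ⟨y, hxy.symm, ?_⟩
    have h₁ : distToSet G y K ≤ G.dist y k := distToSet_le hk
    have h₂ := dist_le w
    have h₃ := distToSet_le_add_one hconn hne hxy
    simp at hw
    omega

end Levels

section Triangles

variable {V : Type*} {G : SimpleGraph V}

/-- A triangle in a level beyond the first has two corners with a common neighbour one level
closer to the clique. -/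
theorem exists_adj_two_of_triangle [Fintype V] [DecidableEq V] (hconn : G.Connected)
    (hGb : IsIndFree G bull) (hGd : IsIndFree G diamond) {K : Finset V}
    (hK : G.IsMaximumClique K) (hcard : 1 < K.card) {n : ℕ} {a b c : V}
    (hab : G.Adj a b) (hac : G.Adj a c) (hbc : G.Adj b c)
    (ha : distToSet G a K = n + 2) (hb : distToSet G b K = n + 2)
    (hc : distToSet G c K = n + 2) :
    ∃ p, distToSet G p K = n + 1 ∧
      ((G.Adj p a ∧ G.Adj p b) ∨ (G.Adj p a ∧ G.Adj p c) ∨ (G.Adj p b ∧ G.Adj p c)) := by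
  by_contra! hno
  have hne : (K : Set V).Nonempty := Finset.coe_nonempty.mpr (Finset.card_pos.mp (by omega))
  obtain ⟨u, hua, hu⟩ := exists_adj_distToSet_eq hconn hne ha
  obtain ⟨v, hvb, hv⟩ := exists_adj_distToSet_eq hconn hne hb
  obtain ⟨w, hwc, hw⟩ := exists_adj_distToSet_eq hconn hne hc
  obtain ⟨hu₁, hu₂, -⟩ := hno u hu
  obtain ⟨hv₁, -, hv₃⟩ := hno v hv
  obtain ⟨-, hw₂, hw₃⟩ := hno w hw
  have hub := hu₁ hua
  have huc := hu₂ hua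
  have hva : ¬ G.Adj v a := fun h => hv₁ h hvb
  have hvc := hv₃ hvb
  have hwa : ¬ G.Adj w a := fun h => hw₂ h hwc
  have hwb : ¬ G.Adj w b := fun h => hw₃ h hwc
  have huv : G.Adj u v := hGb.adj_of_pendants hab hac hbc hua hvb hub huc hva hvc
  have huw : G.Adj u w := hGb.adj_of_pendants hac hab hbc.symm hua hwc huc hub hwa hwb
  have hvw : G.Adj v w := hGb.adj_of_pendants hbc hab.symm hac.symm hvb hwc hvc hva hwb hwa
  have far {x y : V} (h : distToSet G x K + 1 < distToSet G y K) : ¬ G.Adj x y :=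
    not_adj_of_distToSet_lt hconn hne h
  obtain ⟨q, hqu, hq⟩ := exists_adj_distToSet_eq hconn hne hu
  have hqa : ¬ G.Adj q a := far (by omega)
  have hqb : ¬ G.Adj q b := far (by omega)
  have hqc : ¬ G.Adj q c := far (by omega)
  have hqvw : G.Adj q v ∨ G.Adj q w := by
    by_contra! h
    exact hqb (hGb.adj_of_pendants huv huw hvw hqu hvb.symm h.1 h.2
      (fun h => hub h.symm) (fun h => hwb h.symm))
  -- a neighbour of `q` that is adjacent to none of `u`, `v`, `w`
  obtain ⟨k, hkq, hku, hkv, hkw, hka⟩ : ∃ k, G.Adj k q ∧ (G.Adj q u → ¬ G.Adj k u) ∧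
      (G.Adj q v → ¬ G.Adj k v) ∧ (G.Adj q w → ¬ G.Adj k w) ∧ ¬ G.Adj k a := by
    cases n with
    | zero =>
      have mem {x : V} : distToSet G x K = 0 ↔ x ∈ K := by
        simpa using distToSet_eq_zero_iff hconn hne (x := x)
      have hqK := mem.mp hq
      obtain ⟨k, hkK, hkq⟩ := Finset.exists_mem_ne hcard q
      have hk := mem.mpr hkK
      have key {x : V} (hx : distToSet G x K = 0 + 1) (h : G.Adj q x) : ¬ G.Adj k x := fun h' =>
        hK.not_adj_of_adj hGd (fun hxK => by have := mem.mpr hxK; omega) hqK hkK hkq.symm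
          h.symm h'.symm
      exact ⟨k, hK.isClique hkK hqK hkq, key hu, key hv, key hw, far (by omega)⟩
    | succ n =>
      obtain ⟨k, hkq, hk⟩ := exists_adj_distToSet_eq hconn hne hq
      exact ⟨k, hkq, fun _ => far (by omega), fun _ => far (by omega), fun _ => far (by omega),
        far (by omega)⟩
  rcases hqvw with hqv | hqw
  · exact hka (hGb.adj_of_pendants hqu hqv huv hkq hua.symm (hku hqu) (hkv hqv)
      (fun h => hqa h.symm) (fun h => hva h.symm))
  · exact hka (hGb.adj_of_pendants hqu hqw huw hkq hua.symm (hku hqu) (hkw hqw)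
      (fun h => hqa h.symm) (fun h => hwa h.symm))

/-- If `p`, `x`, `b` form a triangle and `q` is a pendant vertex at `p`, then every neighbour of
`x` that is not adjacent to `q` is equal or adjacent to `p`. -/
theorem adj_of_adj_of_pendant (hGb : IsIndFree G bull) (hGd : IsIndFree G diamond)
    {p q x b y : V} (hpx : G.Adj p x) (hpb : G.Adj p b) (hxb : G.Adj x b) (hqp : G.Adj q p)
    (hqx : ¬ G.Adj q x) (hqb : ¬ G.Adj q b) (hxy : G.Adj x y) (hqy : ¬ G.Adj q y) :
    G.Adj p y := by
  by_contra hpy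
  have hne : p ≠ y := fun h => hqy (h ▸ hqp)
  by_cases hby : G.Adj b y
  · exact hpy (hGd.adj_of_common_neighbors hxb hpx.symm hpb.symm hxy hby hne)
  · exact hqy (hGb.adj_of_pendants hpx hpb hxb hqp hxy.symm hqx hqb
      (fun h => hpy h.symm) (fun h => hby h.symm))

end Triangles

theorem statement_16 {V : Type*} [Fintype V] [DecidableEq V] (G : SimpleGraph V)
    (hconn : G.Connected) (hGb : IsIndFree G bull) (hGd : IsIndFree G diamond)
    (hw : 2 < G.cliqueNum) (K : Finset V) (hK : G.IsMaximumClique K)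
    (hsub : ¬ ∃ f : G →g (completeGraph (Fin G.cliqueNum) □ completeGraph (Fin 2)),
      Function.Injective f)
    (i : ℕ) (hi : 2 ≤ i)
    (c : (G.induce (levelSet G (↑K) i)).ConnectedComponent)
    (C : Set V)
    (hC : C = {x | ∃ h : x ∈ levelSet G (↑K) i,
      (G.induce (levelSet G (↑K) i)).connectedComponentMk ⟨x, h⟩ = c})
    (htri : ∃ x ∈ C, ∃ y ∈ C, ∃ z ∈ C, G.Adj x y ∧ G.Adj y z ∧ G.Adj x z) :
    ∀ x ∈ C, ∀ y ∈ levelSet G (↑K) (i + 1), ¬ G.Adj x y := by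
  have hcard : 1 < K.card := by
    rw [maximumClique_card_eq_cliqueNum K hK]
    omega
  have hne : (K : Set V).Nonempty := Finset.coe_nonempty.mpr (Finset.card_pos.mp (by omega))
  have far {x y : V} (h : distToSet G x K + 1 < distToSet G y K) : ¬ G.Adj x y :=
    not_adj_of_distToSet_lt hconn hne h
  obtain ⟨n, rfl⟩ : ∃ n, i = n + 2 := ⟨i - 2, by omega⟩
  subst hC
  obtain ⟨a, ⟨ha, hac⟩, b, ⟨hb, hbc⟩, e, ⟨he, hec⟩, hab, hbe, hae⟩ := htri
  obtain ⟨p, hp, hpT⟩ := exists_adj_two_of_triangle hconn hGb hGd hK hcard hab hae hbe ha hb he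
  obtain ⟨q, hqp, hq⟩ := exists_adj_distToSet_eq hconn hne hp
  let L := G.induce (levelSet G (↑K) (n + 2))
  let P (x : V) : Prop := G.Adj p x ∧ ∃ z ∈ levelSet G (↑K) (n + 2), G.Adj p z ∧ G.Adj x z
  have hfar {x : V} (hx : x ∈ levelSet G (↑K) (n + 2)) : ¬ G.Adj q x :=
    by
    have hx' : distToSet G x K = n + 2 := hx
    exact far (by omega)
  have spread {s t : levelSet G (↑K) (n + 2)} (w : L.Walk s t) (hs : P s) : P t := by
    induction w with
    | nil => exact hs
    | @cons x y _ hxy _ ih =>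
      obtain ⟨hpx, z, hz, hpz, hxz⟩ := hs
      have hxy' : G.Adj x y := hxy
      have hpy : G.Adj p y := adj_of_adj_of_pendant hGb hGd hpx hpz hxz hqp (hfar x.2) (hfar hz)
        hxy' (hfar y.2)
      exact ih ⟨hpy, x, x.2, hpx, hxy'.symm⟩
  obtain ⟨s, hsc, hs⟩ : ∃ s : levelSet G (↑K) (n + 2), L.connectedComponentMk s = c ∧ P s := by
    rcases hpT with ⟨h₁, h₂⟩ | ⟨h₁, h₂⟩ | ⟨h₁, h₂⟩
    · exact ⟨⟨a, ha⟩, hac, h₁, b, hb, h₂, hab⟩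
    · exact ⟨⟨a, ha⟩, hac, h₁, e, he, h₂, hae⟩
    · exact ⟨⟨b, hb⟩, hbc, h₁, e, he, h₂, hbe⟩
  rintro x ⟨hx, hxc⟩ y hy hxy
  obtain ⟨w⟩ := ConnectedComponent.exact (hsc.trans hxc.symm)
  obtain ⟨hpx, z, hz, hpz, hxz⟩ : P x := spread w hs
  have hy' : distToSet G y K = n + 2 + 1 := hy
  exact far (by omega) (adj_of_adj_of_pendant hGb hGd hpx hpz hxz hqp (hfar hx) (hfar hz) hxy
    (far (by omega)))
end
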